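/- arXiv:2406.17819 — 4 statements merged into one kernel-verified Lean document; each statement's English description precedes it below -/
import Mathlib

section
/- Let α ∈ (0,1), m ≥ 1 a natural number, and u₁, …, u_m ∈ ℝ. A point λ* ∈ ℝ minimizes the function λ ↦ Σ_{i=1}^{m} ρ_α(u_i − λ) over ℝ if and only if #{i : u_i > λ*} ≤ α·m and #{i : u_i < λ*} ≤ (1 − α)·m. -/
open Finset

/-- The pinball loss at level `α`: `ρ_α(u) = (1 - α)·u` if `u ≥ 0` and `−α·u` if `u < 0`. -/
noncomputable def pinball (α u : ℝ) : ℝ := if 0 ≤ u then (1 - α) * u else -α * u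

open Filter Topology

theorem pinball_neg (α x : ℝ) : pinball α (-x) = pinball (1 - α) x := by
  unfold pinball
  split_ifs
  · have hx : x = 0 := by linarith
    simp [hx]
  · ring
  · ring
  · linarith

/-- Subgradient inequality for the pinball loss along positive shifts. -/
theorem pinball_add_le_pinball_sub (α x : ℝ) {d : ℝ} (hd : 0 ≤ d) :
    pinball α x + d * (α - if 0 < x then 1 else 0) ≤ pinball α (x - d) := by
  unfold pinball
  split_ifs <;> nlinarith

/-- The subgradient inequality is an equality as long as the shift does not cross the kink. -/
theorem pinball_sub_eq (α x : ℝ) {d : ℝ} (hd : 0 < d) (hx : 0 < x → d ≤ x) :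
    pinball α (x - d) = pinball α x + d * (α - if 0 < x then 1 else 0) := by
  unfold pinball
  by_cases h : 0 < x
  · have := hx h
    rw [if_pos (by linarith), if_pos h.le, if_pos h]
    ring
  · rw [if_neg (by linarith), if_neg h]
    split_ifs
    · have hx0 : x = 0 := by linarith
      subst hx0
      ring
    · ring

theorem sum_pinball_add_shift {ι : Type*} [Fintype ι] (α a d : ℝ) (u : ι → ℝ) :
    ∑ i, (pinball α (u i - a) + d * (α - if 0 < u i - a then 1 else 0)) =
      ∑ i, pinball α (u i - a) +
        d * (α * Fintype.card ι - (univ.filter fun i => a < u i).card) := by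
  simp [sum_add_distrib, ← mul_sum, mul_comm]

/-- Optimality of `a` among the points to its right. -/
theorem sum_pinball_le_right_iff {ι : Type*} [Fintype ι] (α a : ℝ) (u : ι → ℝ) :
    (∀ l, a ≤ l → ∑ i, pinball α (u i - a) ≤ ∑ i, pinball α (u i - l)) ↔
      ((univ.filter fun i => a < u i).card : ℝ) ≤ α * Fintype.card ι := by
  constructor
  · intro h
    obtain ⟨d, hdu, hd⟩ : ∃ d : ℝ, (∀ i, 0 < u i - a → d ≤ u i - a) ∧ 0 < d := by
      have hev : ∀ᶠ d in 𝓝[>] (0 : ℝ), ∀ i, 0 < u i - a → d ≤ u i - a := by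
        refine eventually_all.2 fun i => ?_
        by_cases hi : 0 < u i - a
        · filter_upwards [nhdsWithin_le_nhds (Iic_mem_nhds hi)] with d hd _ using hd
        · exact Eventually.of_forall fun _ h' => absurd h' hi
      exact (hev.and self_mem_nhdsWithin).exists
    have hle := h (a + d) (by linarith)
    have heq : ∑ i, pinball α (u i - (a + d)) = _ :=
      (sum_congr rfl fun i _ => by rw [← sub_sub, pinball_sub_eq α _ hd (hdu i)]).trans
        (sum_pinball_add_shift α a d u)
    rw [heq] at hle
    have := nonneg_of_mul_nonneg_right ((le_add_iff_nonneg_right _).1 hle) hd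
    linarith
  · intro h l hl
    have hle : _ ≤ ∑ i, pinball α (u i - l) := sum_le_sum fun i _ => by
      simpa using pinball_add_le_pinball_sub α (u i - a) (sub_nonneg.2 hl)
    rw [← sub_nonneg] at h
    have hnn := mul_nonneg (sub_nonneg.2 hl) h
    have heq := sum_pinball_add_shift α a (l - a) u
    simp only [sub_pos] at heq hle
    linarith

/-- Optimality of `a` among the points to its left. -/
theorem sum_pinball_le_left_iff {ι : Type*} [Fintype ι] (α a : ℝ) (u : ι → ℝ) :
    (∀ l, l ≤ a → ∑ i, pinball α (u i - a) ≤ ∑ i, pinball α (u i - l)) ↔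
      ((univ.filter fun i => u i < a).card : ℝ) ≤ (1 - α) * Fintype.card ι := by
  have key (l : ℝ) (i : ι) : pinball (1 - α) (-u i - -l) = pinball α (u i - l) := by
    rw [← pinball_neg]
    congr 1
    ring
  have h := sum_pinball_le_right_iff (1 - α) (-a) fun i => -u i
  rw [(neg_surjective (G := ℝ)).forall] at h
  simpa only [neg_lt_neg_iff, neg_le_neg_iff, key] using h

/-- A point `λ*` minimizes the empirical pinball objective `λ ↦ Σᵢ ρ_α(uᵢ − λ)` over `ℝ`
iff `#{i : uᵢ > λ*} ≤ α·m` and `#{i : uᵢ < λ*} ≤ (1 − α)·m`. -/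
theorem pinball_min_iff_quantile (α : ℝ) (hα : α ∈ Set.Ioo (0 : ℝ) 1)
    (m : ℕ) (hm : 1 ≤ m) (u : Fin m → ℝ) (lamStar : ℝ) :
    (∀ l : ℝ, ∑ i, pinball α (u i - lamStar) ≤ ∑ i, pinball α (u i - l)) ↔
      (((univ.filter fun i => lamStar < u i).card : ℝ) ≤ α * m ∧
        ((univ.filter fun i => u i < lamStar).card : ℝ) ≤ (1 - α) * m) := by
  have hr := sum_pinball_le_right_iff α lamStar u
  have hl := sum_pinball_le_left_iff α lamStar u
  rw [Fintype.card_fin] at hr hl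
  rw [← hr, ← hl]
  exact ⟨fun h => ⟨fun l _ => h l, fun l _ => h l⟩,
    fun h l => (le_total lamStar l).elim (h.1 l) (h.2 l)⟩
end

section
/- Let α ∈ (0,1), n ≥ 0 a natural number, and s₁, …, s_{n+1} ∈ ℝ. If λ̂ ∈ ℝ minimizes the function λ ↦ Σ_{i=1}^{n+1} ρ_α(s_i − λ) over ℝ, then (1/(n+1)) · Σ_{i=1}^{n+1} 𝟙{s_i > λ̂} ≤ α. -/
open Finset

/-- Raising the threshold from `l` by a step `ε` that crosses no score changes the pinball loss
of the score `x` by `ε * (α - 𝟙{x > l})`. -/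
lemma pinball_sub_add (α : ℝ) {x l ε : ℝ} (hε : 0 < ε) (h : l < x → l + ε ≤ x) :
    pinball α (x - (l + ε)) = pinball α (x - l) + ε * (α - if l < x then (1 : ℝ) else 0) := by
  unfold pinball
  by_cases hx : l < x
  · have hle := h hx
    rw [if_pos (by linarith), if_pos (by linarith), if_pos hx]
    ring
  · rw [if_neg (by linarith), if_neg hx]
    split_ifs with h0
    · obtain rfl : x = l := by linarith
      ring
    · ring

/-- For finitely many reals there is a positive step from `l` that does not pass any of those
lying above `l`. -/
lemma exists_pos_forall_add_le {ι : Type*} [Finite ι] (s : ι → ℝ) (l : ℝ) :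
    ∃ ε : ℝ, 0 < ε ∧ ∀ i, l < s i → l + ε ≤ s i := by
  have hev : ∀ᶠ ε in nhdsWithin (0 : ℝ) (Set.Ioi 0), ∀ i, l < s i → l + ε ≤ s i := by
    refine Filter.eventually_all.2 fun i => ?_
    by_cases hi : l < s i
    · filter_upwards [Ioo_mem_nhdsGT (sub_pos.2 hi)] with ε hε _
      linarith [hε.2]
    · exact Filter.Eventually.of_forall fun _ h => absurd h hi
  obtain ⟨ε, h, hε⟩ := (hev.and self_mem_nhdsWithin).exists
  exact ⟨ε, hε, h⟩

/-- If `λ̂` minimizes `λ ↦ Σᵢ ρ_α(sᵢ − λ)` over `ℝ`, then the empirical miscoverage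
`(1/(n+1)) Σᵢ 𝟙{sᵢ > λ̂}` is at most `α`. -/
theorem pinball_min_empirical_miscoverage (α : ℝ) (hα : α ∈ Set.Ioo (0 : ℝ) 1)
    (n : ℕ) (s : Fin (n + 1) → ℝ) (lamHat : ℝ)
    (hmin : ∀ l : ℝ, ∑ i, pinball α (s i - lamHat) ≤ ∑ i, pinball α (s i - l)) :
    (1 / (n + 1 : ℝ)) * ∑ i, (if lamHat < s i then (1 : ℝ) else 0) ≤ α := by
  obtain ⟨ε, hε, hstep⟩ := exists_pos_forall_add_le s lamHat
  have h := hmin (lamHat + ε)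
  rw [Finset.sum_congr rfl fun i _ => pinball_sub_add α hε (hstep i), Finset.sum_add_distrib,
    ← Finset.mul_sum, Finset.sum_sub_distrib] at h
  simp only [Finset.sum_const, Finset.card_univ, Fintype.card_fin, nsmul_eq_mul,
    Nat.cast_add, Nat.cast_one] at h
  have hnonneg := nonneg_of_mul_nonneg_right (le_add_iff_nonneg_right _ |>.1 h) hε
  rw [one_div, inv_mul_le_iff₀ (by positivity)]
  linarith
end

section
/- Let (Ω, 𝔽, P) be a probability space, 𝒳 and 𝒴 measurable spaces, n ≥ 0, α ∈ (0,1), and let ((X₁,Y₁), …, (X_{n+1},Y_{n+1})) be an exchangeable random vector with values in (𝒳 × 𝒴)^{n+1}, meaning its law is invariant under every permutation of the n+1 coordinates. Let s : 𝒳 × 𝒴 → ℝ be a measurable score function, and let λ̂ : (𝒳 × 𝒴)^{n+1} → ℝ be a measurable function that is symmetric in its n+1 arguments and such that for every data vector z = (z₁, …, z_{n+1}) ∈ (𝒳 × 𝒴)^{n+1}, λ̂(z) minimizes λ ↦ Σ_{i=1}^{n+1} ρ_α(s(z_i) − λ) over ℝ. Then P( s(X_{n+1}, Y_{n+1}) >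 λ̂((X₁,Y₁), …, (X_{n+1},Y_{n+1})) ) ≤ α; equivalently, the conformal prediction set 𝒞(X_{n+1}) = {y : s(X_{n+1}, y) ≤ λ̂} contains Y_{n+1} with probability at least 1 − α. -/
open MeasureTheory ProbabilityTheory Finset

/-- First-order optimality for intercept-only quantile regression: if `l` minimizes the pinball
objective, then at most a fraction `α` of the observations lies strictly above `l`. -/
theorem card_filter_lt_le_of_pinball_min {ι : Type*} [Fintype ι] {α l : ℝ} {u : ι → ℝ}
    (hmin : ∀ l', ∑ i, pinball α (u i - l) ≤ ∑ i, pinball α (u i - l')) :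
    (#{i | l < u i} : ℝ) ≤ α * Fintype.card ι := by
  have hsmall : ∀ᶠ ε in nhdsWithin (0 : ℝ) (Set.Ioi 0), ∀ i, l < u i → ε < u i - l := by
    refine Filter.eventually_all.2 fun i => ?_
    by_cases h : l < u i
    · filter_upwards [Ioo_mem_nhdsGT (sub_pos.2 h)] with ε hε _ using hε.2
    · exact Filter.Eventually.of_forall fun _ h' => absurd h' h
  obtain ⟨ε, hsep, hε⟩ := (hsmall.and self_mem_nhdsWithin).exists
  replace hε : 0 < ε := hε
  have hstep : ∀ i, pinball α (u i - (l + ε))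
      = pinball α (u i - l) + ε * (α - if l < u i then 1 else 0) := by
    intro i
    by_cases h : l < u i
    · have := hsep i h
      rw [pinball, pinball, if_pos (by linarith), if_pos (by linarith), if_pos h]
      ring
    · rw [pinball, if_neg (by linarith), if_neg h, pinball]
      split_ifs with h0
      · have : u i = l := by linarith
        rw [this]
        ring
      · ring
  have hle := hmin (l + ε)
  simp only [hstep, sum_add_distrib, ← mul_sum, sum_sub_distrib, sum_const, card_univ,
    nsmul_eq_mul, sum_boole] at hle
  have := nonneg_of_mul_nonneg_right (le_add_iff_nonneg_right _ |>.1 hle) hε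
  linarith

/-- If almost surely at most `c` of the events `A i` occur, then their probabilities sum to at
most `c`. -/
theorem sum_measureReal_le_of_sum_indicator_le {Ω ι : Type*} [MeasurableSpace Ω] {μ : Measure Ω}
    [IsProbabilityMeasure μ] [Fintype ι] {A : ι → Set Ω} (hA : ∀ i, MeasurableSet (A i)) {c : ℝ}
    (hc : ∀ᵐ ω ∂μ, ∑ i, (A i).indicator (1 : Ω → ℝ) ω ≤ c) :
    ∑ i, μ.real (A i) ≤ c := by
  have hint : ∀ i ∈ univ, Integrable ((A i).indicator (1 : Ω → ℝ)) μ := fun i _ =>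
    (integrable_const (1 : ℝ)).indicator (hA i)
  calc ∑ i, μ.real (A i) = ∫ ω, ∑ i, (A i).indicator (1 : Ω → ℝ) ω ∂μ := by
        rw [integral_finsetSum _ hint]
        simp only [integral_indicator_one (hA _)]
    _ ≤ ∫ _, c ∂μ := integral_mono_ae (integrable_finsetSum _ hint) (integrable_const c) hc
    _ = c := by simp

/-- Marginal coverage of conformal prediction via intercept-only quantile regression:
if `λ̂` is a symmetric measurable fit minimizing the pinball objective on every data vector,
and the data is exchangeable, then `P(s(X_{n+1},Y_{n+1}) > λ̂) ≤ α`. -/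
theorem conformal_marginal_coverage
    {Ω 𝒳 𝒴 : Type*} [MeasureSpace Ω] [IsProbabilityMeasure (ℙ : Measure Ω)]
    [MeasurableSpace 𝒳] [MeasurableSpace 𝒴]
    (n : ℕ) (α : ℝ) (hα : α ∈ Set.Ioo (0 : ℝ) 1)
    (Z : Ω → Fin (n + 1) → 𝒳 × 𝒴) (hZ : Measurable Z)
    (hexch : ∀ σ : Equiv.Perm (Fin (n + 1)),
      Measure.map (fun ω => fun i => Z ω (σ i)) (ℙ : Measure Ω)
        = Measure.map Z (ℙ : Measure Ω))
    (s : 𝒳 × 𝒴 → ℝ) (hs : Measurable s)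
    (lamHat : (Fin (n + 1) → 𝒳 × 𝒴) → ℝ) (hlam : Measurable lamHat)
    (hsymm : ∀ (σ : Equiv.Perm (Fin (n + 1))) (z : Fin (n + 1) → 𝒳 × 𝒴),
      lamHat (fun i => z (σ i)) = lamHat z)
    (hmin : ∀ (z : Fin (n + 1) → 𝒳 × 𝒴) (l : ℝ),
      ∑ i, pinball α (s (z i) - lamHat z) ≤ ∑ i, pinball α (s (z i) - l)) :
    ((ℙ : Measure Ω) {ω | lamHat (Z ω) < s (Z ω (Fin.last n))}).toReal ≤ α := by
  have hB : ∀ i, MeasurableSet {z : Fin (n + 1) → 𝒳 × 𝒴 | lamHat z < s (z i)} := fun i =>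
    measurableSet_lt hlam (hs.comp (measurable_pi_apply i))
  have heq : ∀ i, (ℙ : Measure Ω).real {ω | lamHat (Z ω) < s (Z ω i)}
      = (ℙ : Measure Ω).real {ω | lamHat (Z ω) < s (Z ω (Fin.last n))} := by
    intro i
    have hperm : Measurable fun ω j => Z ω (Equiv.swap i (Fin.last n) j) :=
      measurable_pi_lambda _ fun j => (measurable_pi_apply _).comp hZ
    have h := congrArg (fun m => m.real {z | lamHat z < s (z (Fin.last n))})
      (hexch (Equiv.swap i (Fin.last n)))
    simp only [map_measureReal_apply hperm (hB _), map_measureReal_apply hZ (hB _),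
      Set.preimage_ofPred_eq, hsymm, Equiv.swap_apply_right] at h
    exact h
  have hsum := sum_measureReal_le_of_sum_indicator_le (μ := (ℙ : Measure Ω)) (fun i => hZ (hB i))
    (c := α * (n + 1)) (Filter.Eventually.of_forall fun ω => by
      simpa [Set.indicator_apply] using
        card_filter_lt_le_of_pinball_min (u := fun i => s (Z ω i)) (hmin (Z ω)))
  simp only [Set.preimage_ofPred_eq, heq, sum_const, card_univ, Fintype.card_fin,
    nsmul_eq_mul, Nat.cast_add, Nat.cast_one] at hsum
  refine le_of_mul_le_mul_left (a := (n : ℝ) + 1) ?_ (by positivity)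
  rwa [mul_comm _ α]
end

section
/- Let α ∈ ℝ, m ≥ 1 a natural number, and for each i ∈ {1, …, m} let ℓ_i : ℝ → ℝ be nonincreasing, right-continuous, and satisfy 0 ≤ ℓ_i(t) ≤ 1 for all t. Define I_i(u) = ∫₀^u (α − ℓ_i(t)) dt. Let Λ ⊆ ℝ^m be a linear subspace, R : ℝ^m → ℝ a function, and define J(v) = (1/m) Σ_{i=1}^{m} I_i(v_i) + R(v). Suppose v̂ ∈ Λ satisfies J(v̂) ≤ J(v) for all v ∈ Λ. Let w ∈ Λ satisfy w_i ≥ 0 for all i, and suppose the right directional derivative r = lim_{ε → 0⁺} (R(v̂ + ε·w) − R(v̂))/ε exists. Then (1/m) Σ_{i=1}^{m} w_i · (ℓ_i(v̂_i) − α) ≤ r. -/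
open Filter Finset

/-- A right-continuous antitone integrand gives a right-differentiable integral function. -/
theorem hasDerivWithinAt_integral_const_sub_of_antitone {f : ℝ → ℝ} (hf : Antitone f)
    (α a u : ℝ) (hrc : ContinuousWithinAt f (Set.Ici u) u) :
    HasDerivWithinAt (fun x => ∫ t in a..x, (α - f t)) (α - f u) (Set.Ici u) u := by
  have hint : IntervalIntegrable (fun t => α - f t) MeasureTheory.volume a u :=
    intervalIntegrable_const.sub hf.intervalIntegrable
  refine intervalIntegral.integral_hasDerivWithinAt_right (t := Set.Ioi u) hint ?_ ?_
  · exact (hf.measurable.const_sub α).stronglyMeasurable.stronglyMeasurableAtFilter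
  · exact (continuousWithinAt_const.sub hrc).mono Set.Ioi_subset_Ici_self

/-- Deterministic core of automatically adaptive conformal risk control:
if `v̂` minimizes the regularized integrated-loss objective `J` over the subspace `Λ`,
then for any nonnegative `w ∈ Λ` whose right directional derivative `r` of `R` at `v̂`
exists, the `w`-weighted empirical excess risk satisfies
`(1/m) Σᵢ wᵢ (ℓᵢ(v̂ᵢ) − α) ≤ r`. -/
theorem weighted_excess_risk_bound (α : ℝ) (m : ℕ) (hm : 1 ≤ m)
    (ℓ : Fin m → ℝ → ℝ)
    (hmono : ∀ i, Antitone (ℓ i))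
    (hrc : ∀ i u, ContinuousWithinAt (ℓ i) (Set.Ici u) u)
    (hbd : ∀ i t, ℓ i t ∈ Set.Icc (0 : ℝ) 1)
    (Λ : Submodule ℝ (Fin m → ℝ)) (R : (Fin m → ℝ) → ℝ)
    (J : (Fin m → ℝ) → ℝ)
    (hJ : J = fun v => (1 / (m : ℝ)) * ∑ i, (∫ t in (0 : ℝ)..(v i), (α - ℓ i t)) + R v)
    (vHat : Fin m → ℝ) (hvHat : vHat ∈ Λ) (hminJ : ∀ v ∈ Λ, J vHat ≤ J v)
    (w : Fin m → ℝ) (hw : w ∈ Λ) (hwpos : ∀ i, 0 ≤ w i) (r : ℝ)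
    (hr : Tendsto (fun ε : ℝ => (R (vHat + ε • w) - R vHat) / ε)
      (nhdsWithin 0 (Set.Ioi 0)) (nhds r)) :
    (1 / (m : ℝ)) * ∑ i, w i * (ℓ i (vHat i) - α) ≤ r := by
  have hderiv : HasDerivWithinAt
      (fun ε : ℝ => (1 / (m : ℝ)) * ∑ i, ∫ t in (0 : ℝ)..((vHat + ε • w) i), (α - ℓ i t))
      ((1 / (m : ℝ)) * ∑ i, (α - ℓ i (vHat i)) * w i) (Set.Ici 0) 0 := by
    refine (HasDerivWithinAt.fun_sum fun i _ => ?_).const_mul _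
    have hline : HasDerivWithinAt (fun ε : ℝ => (vHat + ε • w) i) (w i) (Set.Ici 0) 0 := by
      simpa using (((hasDerivAt_id (0 : ℝ)).mul_const (w i)).const_add (vHat i)).hasDerivWithinAt
    have hmaps : Set.MapsTo (fun ε : ℝ => (vHat + ε • w) i) (Set.Ici 0) (Set.Ici (vHat i)) := by
      intro ε hε
      simpa using mul_nonneg hε (hwpos i)
    exact HasDerivWithinAt.comp_of_eq 0
      (hasDerivWithinAt_integral_const_sub_of_antitone (hmono i) α 0 _ (hrc i _))
      hline hmaps (by simp)
  have hslope := hasDerivWithinAt_iff_tendsto_slope.1 hderiv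
  rw [Set.Ici_sdiff_left] at hslope
  have hnonneg : 0 ≤ (1 / (m : ℝ)) * ∑ i, (α - ℓ i (vHat i)) * w i + r := by
    refine ge_of_tendsto (hslope.add hr) ?_
    filter_upwards [self_mem_nhdsWithin] with ε hε
    have hle := hminJ _ (Λ.add_mem hvHat (Λ.smul_mem ε hw))
    simp only [hJ] at hle
    rw [slope_def_field, sub_zero, zero_smul, add_zero, ← add_div]
    exact div_nonneg (by linarith) (le_of_lt hε)
  have hneg : ∑ i, w i * (ℓ i (vHat i) - α) = -∑ i, (α - ℓ i (vHat i)) * w i := by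
    rw [← Finset.sum_neg_distrib]
    exact Finset.sum_congr rfl fun i _ => by ring
  rw [hneg]
  linarith
end
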